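/- For every non-negative integer N, the ℚ-linear span (inside the ℂ-vector space of functions from {s ∈ ℂ : Re(s) > 2} to ℂ) of the functions {s ↦ Z_c(s) : 0 ≤ c ≤ N} equals the ℚ-linear span of the functions {s ↦ Z_c(s) : 0 ≤ c ≤ N, c even}. -/

import Mathlib

/-- The Euler–Zagier double zeta function `ζ(-c, s+c) = ∑_{m,n ≥ 1} m^c / (m+n)^(s+c)`. -/
noncomputable def Z (c : ℕ) (s : ℂ) : ℂ :=
  ∑' p : ℕ+ × ℕ+, ((p.1 : ℕ) : ℂ) ^ c / ((((p.1 : ℕ) + (p.2 : ℕ) : ℕ)) : ℂ) ^ (s + (c : ℂ))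

/-- The function `s ↦ Z_c(s)` viewed as a function on `{s : ℂ | Re s > 2}`. -/
noncomputable def F (c : ℕ) : {s : ℂ // 2 < s.re} → ℂ := fun s => Z c s.val

/-- The general term of `Z_c(s)`, written as `(m / (m + n)) ^ c * (m + n) ^ (-s)`. -/
theorem Z_term_eq (c : ℕ) (s : ℂ) (p : ℕ+ × ℕ+) :
    ((p.1 : ℕ) : ℂ) ^ c / ((((p.1 : ℕ) + (p.2 : ℕ) : ℕ)) : ℂ) ^ (s + (c : ℂ)) =
      (((p.1 : ℕ) : ℂ) / (((p.1 : ℕ) + (p.2 : ℕ) : ℕ) : ℂ)) ^ c *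
        ((((p.1 : ℕ) + (p.2 : ℕ) : ℕ)) : ℂ) ^ (-s) := by
  have h : ((((p.1 : ℕ) + (p.2 : ℕ) : ℕ)) : ℂ) ≠ 0 := by
    have := p.1.pos
    exact_mod_cast (by omega : (p.1 : ℕ) + (p.2 : ℕ) ≠ 0)
  rw [Complex.cpow_add _ _ h, Complex.cpow_natCast, Complex.cpow_neg, div_pow, div_mul_eq_mul_div,
    ← div_eq_mul_inv, div_div, div_eq_div_iff] <;>
  simp [Complex.cpow_eq_zero_iff, h, -Nat.cast_add]

theorem summable_add_rpow_neg {σ : ℝ} (hσ : 2 < σ) :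
    Summable fun p : ℕ+ × ℕ+ => (((p.1 : ℕ) + (p.2 : ℕ) : ℕ) : ℝ) ^ (-σ) := by
  have h1 : Summable fun n : ℕ+ => ((n : ℕ) : ℝ) ^ (-(σ / 2)) :=
    (Real.summable_nat_rpow.2 (by linarith)).comp_injective PNat.coe_injective
  have h2 := h1.mul_of_nonneg h1 (fun n => by positivity) (fun n => by positivity)
  refine Summable.of_nonneg_of_le (fun p => by positivity) (fun p => ?_) h2
  have ha : (0 : ℝ) < ((p.1 : ℕ) : ℝ) := by exact_mod_cast p.1.pos
  have hb : (0 : ℝ) < ((p.2 : ℕ) : ℝ) := by exact_mod_cast p.2.pos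
  rw [← Real.mul_rpow ha.le hb.le, Nat.cast_add]
  have h3 : (((p.1 : ℕ) : ℝ) + ((p.2 : ℕ) : ℝ)) ^ (-σ) =
      ((((p.1 : ℕ) : ℝ) + ((p.2 : ℕ) : ℝ)) ^ (2 : ℕ)) ^ (-(σ / 2)) := by
    rw [← Real.rpow_natCast, ← Real.rpow_mul (by positivity)]
    congr 1
    push_cast
    ring
  rw [h3]
  exact Real.rpow_le_rpow_of_nonpos (by positivity) (by nlinarith) (by linarith)

theorem summable_Z_term (c : ℕ) {s : ℂ} (hs : 2 < s.re) :
    Summable fun p : ℕ+ × ℕ+ => (((p.1 : ℕ) : ℂ) / (((p.1 : ℕ) + (p.2 : ℕ) : ℕ) : ℂ)) ^ c *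
      ((((p.1 : ℕ) + (p.2 : ℕ) : ℕ)) : ℂ) ^ (-s) := by
  refine Summable.of_norm_bounded (summable_add_rpow_neg hs) (fun p => ?_)
  have h : 0 < (p.1 : ℕ) + (p.2 : ℕ) := by have := p.1.pos; omega
  rw [norm_mul, Complex.norm_natCast_cpow_of_pos h, Complex.neg_re, norm_pow, norm_div,
    Complex.norm_natCast, Complex.norm_natCast]
  refine mul_le_of_le_one_left (by positivity) (pow_le_one₀ (by positivity) ?_)
  exact div_le_one_of_le₀ (by exact_mod_cast Nat.le_add_right _ _) (by positivity)

/-- The relation coming from the symmetry `m ↔ n` of the double series. -/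
theorem F_eq_sum (c : ℕ) :
    F c = ∑ j ∈ Finset.range (c + 1), ((-1) ^ j * (c.choose j : ℚ)) • F j := by
  funext ⟨s, hs⟩
  simp only [F, Z, Z_term_eq, Finset.sum_apply, Pi.smul_apply]
  rw [← (Equiv.prodComm ℕ+ ℕ+).tsum_eq]
  have h : ∀ j : ℕ, ((-1) ^ j * (c.choose j : ℚ)) • (∑' p : ℕ+ × ℕ+,
      (((p.1 : ℕ) : ℂ) / (((p.1 : ℕ) + (p.2 : ℕ) : ℕ) : ℂ)) ^ j *
        ((((p.1 : ℕ) + (p.2 : ℕ) : ℕ)) : ℂ) ^ (-s)) =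
      ∑' p : ℕ+ × ℕ+, ((-1) ^ j * (c.choose j : ℂ)) *
        ((((p.1 : ℕ) : ℂ) / (((p.1 : ℕ) + (p.2 : ℕ) : ℕ) : ℂ)) ^ j *
          ((((p.1 : ℕ) + (p.2 : ℕ) : ℕ)) : ℂ) ^ (-s)) := by
    intro j
    rw [tsum_mul_left, Rat.smul_def]
    push_cast
    rfl
  simp only [h]
  rw [← Summable.tsum_finsetSum fun j _ => (summable_Z_term j hs).mul_left _]
  refine tsum_congr fun p => ?_
  have h0 : (((p.1 : ℕ) : ℂ) + ((p.2 : ℕ) : ℂ)) ≠ 0 := by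
    have := p.1.pos
    exact_mod_cast (by omega : (p.1 : ℕ) + (p.2 : ℕ) ≠ 0)
  have hx : ((p.2 : ℕ) : ℂ) / (((p.1 : ℕ) + (p.2 : ℕ) : ℕ) : ℂ) =
      -(((p.1 : ℕ) : ℂ) / (((p.1 : ℕ) + (p.2 : ℕ) : ℕ) : ℂ)) + 1 := by
    push_cast
    field_simp
    ring
  simp only [Equiv.prodComm_apply, Prod.fst_swap, Prod.snd_swap]
  rw [add_comm (p.2 : ℕ) (p.1 : ℕ), hx, add_pow, Finset.sum_mul]
  refine Finset.sum_congr rfl fun j _ => ?_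
  rw [neg_pow]
  ring

theorem F_mem_span_even (N c : ℕ) (hc : c ≤ N) :
    F c ∈ Submodule.span ℚ (F '' {c | c ≤ N ∧ Even c}) := by
  induction c using Nat.strong_induction_on with
  | _ c ih =>
    rcases Nat.even_or_odd c with he | ho
    · exact Submodule.subset_span ⟨c, ⟨hc, he⟩, rfl⟩
    · have h := F_eq_sum c
      rw [Finset.sum_range_succ, ho.neg_one_pow, Nat.choose_self, Nat.cast_one, mul_one,
        neg_one_smul, ← sub_eq_add_neg, eq_sub_iff_add_eq, ← two_smul ℚ] at h
      rw [← Submodule.smul_mem_iff _ (two_ne_zero : (2 : ℚ) ≠ 0), h]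
      refine Submodule.sum_mem _ fun j hj => Submodule.smul_mem _ _ ?_
      have hjc := Finset.mem_range.1 hj
      exact ih j hjc (by omega)

/-- For every `N`, the `ℚ`-span of `{s ↦ Z_c(s) : 0 ≤ c ≤ N}` equals the `ℚ`-span of
`{s ↦ Z_c(s) : 0 ≤ c ≤ N, c even}`. -/
theorem span_eq_span_even (N : ℕ) :
    Submodule.span ℚ (F '' {c | c ≤ N}) =
      Submodule.span ℚ (F '' {c | c ≤ N ∧ Even c}) := by
  apply le_antisymm
  · rw [Submodule.span_le]
    rintro _ ⟨c, hc, rfl⟩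
    exact F_mem_span_even N c hc
  · exact Submodule.span_mono (Set.image_mono fun c hc => hc.1)
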